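/- There is a constant C > 0 such that for every real X ≥ 2, the number of quadruples (n₀, n₁, n₂, n₃) ∈ ℤ⁴ with |nᵢ| ≤ X for all i, n₃ ≠ 0, and such that n₁²n₂² − 4n₁³n₃ − 4n₀n₂³ − 27n₀²n₃² + 18n₀n₁n₂n₃ is a perfect square (i.e., equals m² for some m ∈ ℤ), is at most C X³ log X. -/

import Mathlib

open scoped Classical

noncomputable section

theorem exists_card_divisors_pow_le (k : ℕ) :
    ∃ C : ℕ, ∀ n : ℕ, n ≠ 0 → n.divisors.card ^ k ≤ C * n := by
  obtain ⟨c, hc, hpow⟩ : ∃ c : ℕ, 0 < c ∧ ∀ v : ℕ, (v + 1) ^ k ≤ c * 2 ^ v := by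
    have h := tendsto_pow_const_div_const_pow_of_one_lt k (r := (2 : ℝ)) (by norm_num)
    obtain ⟨B, hB⟩ := h.bddAbove_range
    refine ⟨2 * (⌈B⌉₊ + 1), by positivity, fun v => ?_⟩
    have h1 : ((v + 1 : ℕ) : ℝ) ^ k / 2 ^ (v + 1) ≤ B := hB ⟨v + 1, rfl⟩
    rw [div_le_iff₀ (by positivity)] at h1
    have h2 : B ≤ (⌈B⌉₊ + 1 : ℝ) := (Nat.le_ceil B).trans (by linarith)
    have h3 : (((v + 1) ^ k : ℕ) : ℝ) ≤ ((2 * (⌈B⌉₊ + 1) * 2 ^ v : ℕ) : ℝ) := by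
      push_cast at h1 ⊢
      calc ((v : ℝ) + 1) ^ k ≤ B * 2 ^ (v + 1) := h1
        _ ≤ (⌈B⌉₊ + 1) * 2 ^ (v + 1) := by gcongr
        _ = _ := by ring
    exact_mod_cast h3
  refine ⟨c ^ (2 ^ k), fun n hn => ?_⟩
  have hlocal : ∀ p ∈ n.primeFactors, (n.factorization p + 1) ^ k ≤
      (if p < 2 ^ k then c else 1) * p ^ n.factorization p := by
    intro p hp
    have hp2 : 2 ≤ p := (Nat.prime_of_mem_primeFactors hp).two_le
    split_ifs with h
    · exact (hpow _).trans (by gcongr)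
    · calc (n.factorization p + 1) ^ k ≤ (2 ^ n.factorization p) ^ k := by
            gcongr; exact Nat.lt_two_pow_self
        _ = (2 ^ k) ^ n.factorization p := by rw [← pow_mul, ← pow_mul, mul_comm]
        _ ≤ p ^ n.factorization p := by gcongr; omega
        _ = _ := by simp
  have hsmall : ∏ p ∈ n.primeFactors, (if p < 2 ^ k then c else 1) ≤ c ^ (2 ^ k) := by
    rw [Finset.prod_ite, Finset.prod_const, Finset.prod_const_one, mul_one]
    refine Nat.pow_le_pow_right hc ?_
    calc _ ≤ (Finset.range (2 ^ k)).card := Finset.card_le_card fun p hp => by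
            simpa using (Finset.mem_filter.mp hp).2
      _ = 2 ^ k := by simp
  calc n.divisors.card ^ k
      = ∏ p ∈ n.primeFactors, (n.factorization p + 1) ^ k := by
        rw [Nat.card_divisors hn, Finset.prod_pow]
    _ ≤ ∏ p ∈ n.primeFactors, ((if p < 2 ^ k then c else 1) * p ^ n.factorization p) :=
        Finset.prod_le_prod' hlocal
    _ = (∏ p ∈ n.primeFactors, (if p < 2 ^ k then c else 1)) * n := by
        rw [Finset.prod_mul_distrib]
        congr 1
        exact Nat.prod_factorization_pow_eq_self hn
    _ ≤ c ^ (2 ^ k) * n := by gcongr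

/-- A residue class modulo `e ≥ s` has at most `2N/s + 1` members in `[-N, N]`. -/
theorem card_le_of_forall_dvd_sub {S : Finset ℤ} {N e s : ℕ} {r : ℤ} (hs : 0 < s) (hse : s ≤ e)
    (hN : ∀ b ∈ S, |b| ≤ N) (hr : ∀ b ∈ S, (e : ℤ) ∣ b - r) : S.card ≤ 2 * N / s + 1 := by
  have he : (0 : ℤ) < e := by omega
  calc S.card ≤ (Finset.range (2 * N / e + 1)).card := by
        refine Finset.card_le_card_of_injOn (fun b => ((b + N) / e).toNat) ?_ ?_
        · intro b hb
          have h := abs_le.mp (hN b hb)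
          have h1 : (b + N) / (e : ℤ) ≤ (2 * N) / e := Int.ediv_le_ediv he (by linarith)
          have h2 : 0 ≤ (b + N) / (e : ℤ) := Int.ediv_nonneg (by linarith) he.le
          simp only [Finset.coe_range, Set.mem_Iio]
          zify
          rw [Int.toNat_of_nonneg h2]
          omega
        · intro b hb b' hb' hbb
          have h := abs_le.mp (hN b hb)
          have h' := abs_le.mp (hN b' hb')
          have h2 : 0 ≤ (b + N) / (e : ℤ) := Int.ediv_nonneg (by linarith) he.le
          have h2' : 0 ≤ (b' + N) / (e : ℤ) := Int.ediv_nonneg (by linarith) he.le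
          have hq : (b + N) / (e : ℤ) = (b' + N) / e := by
            dsimp only at hbb
            omega
          have hmod : (b + N) % (e : ℤ) = (b' + N) % e := by
            refine Int.modEq_iff_dvd.mpr ?_
            rw [show b' + N - (b + N) = b' - r - (b - r) by ring]
            exact dvd_sub (hr b' hb') (hr b hb)
          have := Int.emod_add_mul_ediv (b + N) e
          have := Int.emod_add_mul_ediv (b' + N) e
          rw [hmod, hq] at *
          linarith
    _ = 2 * N / e + 1 := by simp
    _ ≤ 2 * N / s + 1 := by gcongr

theorem dvd_of_gcd_eq {e f : ℕ} {u w : ℤ} (he : 0 < e) (h : ((e * f : ℕ) : ℤ) ∣ u * w)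
    (hgcd : Int.gcd (e * f : ℕ) u = e) : (f : ℤ) ∣ w := by
  have h1 : e * f ∣ u.natAbs * w.natAbs := by
    rwa [← Int.natAbs_mul, ← Int.natCast_dvd]
  have h2 : e * f ∣ Nat.gcd (e * f) u.natAbs * w.natAbs := dvd_gcd_mul_of_dvd_mul h1
  rw [show Nat.gcd (e * f) u.natAbs = e from hgcd] at h2
  exact Int.natCast_dvd.mpr (Nat.dvd_of_mul_dvd_mul_left he h2)

/-- If `s² ≤ q`, the congruence `b² ≡ A` modulo `q` has at most `(2N/s + 1) d(q)` solutions
in `[-N, N]`: two solutions satisfy `q ∣ (b - b₀) (b + b₀)`. -/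
theorem card_sq_congruent_le {S : Finset ℤ} {N q s : ℕ} {A : ℤ} (hs : 0 < s) (hsq : s ^ 2 ≤ q)
    (hN : ∀ b ∈ S, |b| ≤ N) (hA : ∀ b ∈ S, (q : ℤ) ∣ b ^ 2 - A) :
    S.card ≤ (2 * N / s + 1) * q.divisors.card := by
  have hq : q ≠ 0 := by
    have := pow_pos hs 2
    omega
  rcases S.eq_empty_or_nonempty with rfl | ⟨b₀, hb₀⟩
  · simp
  refine Finset.card_le_mul_card_image_of_maps_to (f := fun b => Int.gcd q (b - b₀)) ?_ _ ?_
  · intro b _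
    have : (Int.gcd q (b - b₀) : ℤ) ∣ q := Int.gcd_dvd_left ..
    exact Nat.mem_divisors.mpr ⟨by exact_mod_cast this, hq⟩
  · intro e he
    obtain ⟨f, rfl⟩ := (Nat.mem_divisors.mp he).1
    have hef : s ≤ e ∨ s ≤ f := by
      by_contra! h
      nlinarith
    rcases hef with h | h
    · refine card_le_of_forall_dvd_sub (r := b₀) hs h
        (fun b hb => hN b (Finset.mem_filter.mp hb).1) ?_
      intro b hb
      rw [← (Finset.mem_filter.mp hb).2]
      exact Int.gcd_dvd_right ..
    · refine card_le_of_forall_dvd_sub (r := -b₀) hs h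
        (fun b hb => hN b (Finset.mem_filter.mp hb).1) ?_
      intro b hb
      obtain ⟨hbS, hbe⟩ := Finset.mem_filter.mp hb
      refine dvd_of_gcd_eq (Nat.pos_of_ne_zero (left_ne_zero_of_mul hq)) ?_ hbe
      rw [show (b - b₀) * (b - -b₀) = b ^ 2 - A - (b₀ ^ 2 - A) by ring]
      exact dvd_sub (hA b hbS) (hA b₀ hb₀)

theorem card_primitive_sq_add_three_mul_sq_le {S : Finset (ℤ × ℤ)} {n : ℕ} (hn : 0 < n)
    (hS : ∀ p ∈ S, p.1 ^ 2 + 3 * p.2 ^ 2 = n) (hcop : ∀ p ∈ S, IsCoprime p.1 p.2) :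
    S.card ≤ 26 * n.divisors.card := by
  rcases S.eq_empty_or_nonempty with rfl | ⟨⟨x₀, y₀⟩, h₀⟩
  · simp
  have hcopn : ∀ p ∈ S, IsCoprime (n : ℤ) p.2 := by
    intro p hp
    rw [← hS p hp, sq p.2, ← mul_assoc]
    exact (IsCoprime.add_mul_right_left_iff).mpr (hcop p hp).pow_left
  have hS₀ := hS _ h₀
  dsimp only at hS₀
  refine Finset.card_le_mul_card_image_of_maps_to
    (f := fun p => Int.gcd n (p.1 * y₀ - x₀ * p.2)) ?_ _ ?_
  · intro p _
    have : (Int.gcd n (p.1 * y₀ - x₀ * p.2) : ℤ) ∣ n := Int.gcd_dvd_left ..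
    exact Nat.mem_divisors.mpr ⟨by exact_mod_cast this, hn.ne'⟩
  intro e he
  obtain ⟨f, hef⟩ := (Nat.mem_divisors.mp he).1
  have hepos : 0 < e := Nat.pos_of_mem_divisors he
  set F := S.filter fun p => Int.gcd n (p.1 * y₀ - x₀ * p.2) = e
  have hdvd : ∀ p ∈ F, (e : ℤ) ∣ p.1 * y₀ - x₀ * p.2 ∧ (f : ℤ) ∣ p.1 * y₀ + x₀ * p.2 := by
    intro p hp
    obtain ⟨hpS, hpe⟩ := Finset.mem_filter.mp hp
    refine ⟨hpe ▸ Int.gcd_dvd_right .., ?_⟩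
    have hpn := hS p hpS
    rw [hef] at hpe
    refine dvd_of_gcd_eq hepos ?_ hpe
    rw [← hef]
    exact ⟨y₀ ^ 2 - p.2 ^ 2, by linear_combination y₀ ^ 2 * hpn - p.2 ^ 2 * hS₀⟩
  rcases F.eq_empty_or_nonempty with hemp | ⟨⟨x', y'⟩, h'⟩
  · simp [hemp]
  have hS' := hS _ (Finset.mem_filter.mp h').1
  have hen : (e : ℤ) ∣ n := ⟨f, by exact_mod_cast hef⟩
  have hfn : (f : ℤ) ∣ n := ⟨e, by rw [hef]; push_cast; ring⟩
  have hy₀ := hcopn _ h₀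
  have hy' := hcopn _ (Finset.mem_filter.mp h').1
  obtain ⟨h'e, h'f⟩ := hdvd _ h'
  dsimp only at hS' hy₀ hy' h'e h'f
  have hgcd : Nat.gcd e f ∣ 12 := by
    have hge : (Nat.gcd e f : ℤ) ∣ e := Int.natCast_dvd_natCast.mpr (Nat.gcd_dvd_left e f)
    have hgf : (Nat.gcd e f : ℤ) ∣ f := Int.natCast_dvd_natCast.mpr (Nat.gcd_dvd_right e f)
    have hgn := hge.trans hen
    have h2 : (Nat.gcd e f : ℤ) ∣ 2 * x' := by
      refine (hy₀.of_isCoprime_of_dvd_left hgn).dvd_of_dvd_mul_right ?_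
      convert dvd_add (hge.trans h'e) (hgf.trans h'f) using 1
      ring
    have h12 : (Nat.gcd e f : ℤ) ∣ 12 := by
      have hc := hy'.of_isCoprime_of_dvd_left hgn
      refine (hc.pow_right (n := 2)).dvd_of_dvd_mul_right ?_
      convert dvd_sub (hgn.mul_left 4) (h2.mul_left (2 * x')) using 1
      linear_combination 4 * hS'
    exact_mod_cast h12
  have hcross : ∀ p ∈ F, (n : ℤ) ∣ 12 * (p.1 * y' - x' * p.2) := by
    intro p hp
    obtain ⟨hpe, hpf⟩ := hdvd p hp
    have h1 : (e : ℤ) ∣ p.1 * y' - x' * p.2 := by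
      refine (hy₀.of_isCoprime_of_dvd_left hen).dvd_of_dvd_mul_right ?_
      convert dvd_sub (hpe.mul_right y') (h'e.mul_right p.2) using 1
      ring
    have h2 : (f : ℤ) ∣ p.1 * y' - x' * p.2 := by
      refine (hy₀.of_isCoprime_of_dvd_left hfn).dvd_of_dvd_mul_right ?_
      convert dvd_sub (hpf.mul_right y') (h'f.mul_right p.2) using 1
      ring
    have h3 : (Nat.lcm e f : ℤ) ∣ p.1 * y' - x' * p.2 :=
      Int.natCast_dvd.mpr (Nat.lcm_dvd (Int.natCast_dvd.mp h1) (Int.natCast_dvd.mp h2))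
    have h4 := mul_dvd_mul (Int.natCast_dvd_natCast.mpr hgcd) h3
    rwa [← Nat.cast_mul, Nat.gcd_mul_lcm, ← hef] at h4
  have hnorm : ∀ p ∈ F, (p.1 * x' + 3 * p.2 * y') ^ 2 + 3 * (p.1 * y' - x' * p.2) ^ 2 = n ^ 2 := by
    intro p hp
    have hpn := hS p (Finset.mem_filter.mp hp).1
    linear_combination (x' ^ 2 + 3 * y' ^ 2) * hpn + n * hS'
  have hnZ : (0 : ℤ) < n := by exact_mod_cast hn
  calc F.card ≤ (Finset.Icc (-6 : ℤ) 6 ×ˢ (Finset.univ : Finset Bool)).card := by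
        refine Finset.card_le_card_of_injOn (fun p => (12 * (p.1 * y' - x' * p.2) / n,
          decide (0 ≤ p.1 * x' + 3 * p.2 * y'))) ?_ ?_
        · intro p hp
          obtain ⟨j, hj⟩ := hcross p hp
          have hp2 := hnorm p hp
          have hj2 : 3 * j ^ 2 ≤ 144 := by
            have h1 : (n : ℤ) ^ 2 * (3 * j ^ 2) ≤ n ^ 2 * 144 := by
              have h2 : ((n : ℤ) * j) ^ 2 = 144 * (p.1 * y' - x' * p.2) ^ 2 := by
                rw [← hj]; ring
              nlinarith [sq_nonneg (p.1 * x' + 3 * p.2 * y')]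
            exact le_of_mul_le_mul_left h1 (by positivity)
          simp only [hj, Int.mul_ediv_cancel_left _ hnZ.ne', Finset.coe_product, Set.mem_prod,
            Finset.coe_Icc, Set.mem_Icc, Finset.coe_univ, Set.mem_univ, and_true]
          constructor <;> nlinarith
        · intro p hp q hq hpq
          obtain ⟨hw, hv⟩ := Prod.mk.inj hpq
          obtain ⟨i, hi⟩ := hcross p hp
          obtain ⟨j, hj⟩ := hcross q hq
          rw [hi, hj, Int.mul_ediv_cancel_left _ hnZ.ne', Int.mul_ediv_cancel_left _ hnZ.ne'] at hw
          have hwe : p.1 * y' - x' * p.2 = q.1 * y' - x' * q.2 := by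
            rw [hw] at hi
            linarith
          have hve : p.1 * x' + 3 * p.2 * y' = q.1 * x' + 3 * q.2 * y' := by
            have h1 := hnorm p hp
            have h2 := hnorm q hq
            rw [hwe] at h1
            have h3 : (p.1 * x' + 3 * p.2 * y') ^ 2 = (q.1 * x' + 3 * q.2 * y') ^ 2 := by linarith
            rw [decide_eq_decide] at hv
            rcases sq_eq_sq_iff_eq_or_eq_neg.mp h3 with h | h
            · exact h
            · rw [h] at hv ⊢
              omega
          refine Prod.ext (mul_left_cancel₀ hnZ.ne' ?_) (mul_left_cancel₀ hnZ.ne' ?_)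
          · rw [← hS']
            linear_combination x' * hve + 3 * y' * hwe
          · rw [← hS']
            linear_combination y' * hve - x' * hwe
    _ = 26 := by simp

theorem card_sq_add_three_mul_sq_le {S : Finset (ℤ × ℤ)} {n : ℕ} (hn : 0 < n)
    (hS : ∀ p ∈ S, p.1 ^ 2 + 3 * p.2 ^ 2 = n) :
    S.card ≤ 26 * n.divisors.card ^ 2 := by
  have hdvd : ∀ p ∈ S, Int.gcd p.1 p.2 ^ 2 ∣ n := by
    intro p hp
    have h1 : (Int.gcd p.1 p.2 : ℤ) ^ 2 ∣ n := by
      rw [← hS p hp]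
      exact dvd_add (pow_dvd_pow_of_dvd (Int.gcd_dvd_left ..) 2)
        ((pow_dvd_pow_of_dvd (Int.gcd_dvd_right ..) 2).mul_left 3)
    exact_mod_cast h1
  rw [sq, ← mul_assoc]
  refine Finset.card_le_mul_card_image_of_maps_to (f := fun p => Int.gcd p.1 p.2) ?_ _ ?_
  · intro p hp
    exact Nat.mem_divisors.mpr ⟨(dvd_pow_self _ two_ne_zero).trans (hdvd p hp), hn.ne'⟩
  intro g _
  set F := S.filter fun p => Int.gcd p.1 p.2 = g
  rcases F.eq_empty_or_nonempty with hemp | ⟨p₀, hp₀⟩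
  · simp [hemp]
  obtain ⟨k, hk⟩ : g ^ 2 ∣ n := by
    obtain ⟨h1, h2⟩ := Finset.mem_filter.mp hp₀
    exact h2 ▸ hdvd p₀ h1
  have hg : 0 < g := Nat.pos_of_ne_zero fun h => by simp [h] at hk; omega
  have hkpos : 0 < k := Nat.pos_of_ne_zero fun h => by simp [h] at hk; omega
  have hgZ : (0 : ℤ) < g := by exact_mod_cast hg
  have hfac : ∀ p ∈ F, p.1 = g * (p.1 / g) ∧ p.2 = g * (p.2 / g) := by
    intro p hp
    obtain ⟨_, h2⟩ := Finset.mem_filter.mp hp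
    exact ⟨(Int.mul_ediv_cancel' (h2 ▸ Int.gcd_dvd_left ..)).symm,
      (Int.mul_ediv_cancel' (h2 ▸ Int.gcd_dvd_right ..)).symm⟩
  have hinj : Set.InjOn (fun p : ℤ × ℤ => (p.1 / (g : ℤ), p.2 / (g : ℤ))) F := by
    intro p hp q hq hpq
    obtain ⟨h1, h2⟩ := Prod.mk.inj hpq
    refine Prod.ext ?_ ?_
    · rw [(hfac p hp).1, (hfac q hq).1, h1]
    · rw [(hfac p hp).2, (hfac q hq).2, h2]
  rw [← Finset.card_image_of_injOn hinj]
  calc _ ≤ 26 * k.divisors.card := by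
        refine card_primitive_sq_add_three_mul_sq_le hkpos ?_ ?_
        · intro r hr
          obtain ⟨p, hp, rfl⟩ := Finset.mem_image.mp hr
          have h1 := hS p (Finset.mem_filter.mp hp).1
          rw [hk, (hfac p hp).1, (hfac p hp).2] at h1
          push_cast at h1
          refine mul_left_cancel₀ (pow_ne_zero 2 hgZ.ne') ?_
          linear_combination h1
        · intro r hr
          obtain ⟨p, hp, rfl⟩ := Finset.mem_image.mp hr
          have h2 := (Finset.mem_filter.mp hp).2
          rw [Int.isCoprime_iff_gcd_eq_one]
          rw [← h2]
          exact Int.gcd_ediv_gcd_ediv_gcd (h2 ▸ hg)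
    _ ≤ 26 * n.divisors.card := by
        gcongr
        exact ⟨g ^ 2, by rw [hk, mul_comm]⟩

/-- The discriminant of the cubic `v.2.2.2 x³ + v.2.2.1 x² + v.2.1 x + v.1`. -/
def cubicDisc (v : ℤ × ℤ × ℤ × ℤ) : ℤ :=
  v.2.1 ^ 2 * v.2.2.1 ^ 2 - 4 * v.2.1 ^ 3 * v.2.2.2 - 4 * v.1 * v.2.2.1 ^ 3
    - 27 * v.1 ^ 2 * v.2.2.2 ^ 2 + 18 * v.1 * v.2.1 * v.2.2.1 * v.2.2.2

/-- The leading coefficient of the Hessian covariant of the cubic. -/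
def hessianLead (v : ℤ × ℤ × ℤ × ℤ) : ℤ := v.2.2.1 ^ 2 - 3 * v.2.2.2 * v.2.1

/-- The leading coefficient of the cubic covariant of the cubic. -/
def covariantLead (v : ℤ × ℤ × ℤ × ℤ) : ℤ :=
  2 * v.2.2.1 ^ 3 - 9 * v.2.2.2 * v.2.2.1 * v.2.1 + 27 * v.2.2.2 ^ 2 * v.1

theorem covariantLead_sq_add (v : ℤ × ℤ × ℤ × ℤ) :
    covariantLead v ^ 2 + 27 * v.2.2.2 ^ 2 * cubicDisc v = 4 * hessianLead v ^ 3 := by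
  unfold covariantLead cubicDisc hessianLead
  ring

/-- The leading coefficient of the cubic covariant, paired with `3 * v.2.2.2 * √disc`. -/
def covariantPair (v : ℤ × ℤ × ℤ × ℤ) : ℤ × ℤ :=
  (covariantLead v, 3 * v.2.2.2 * Int.sqrt (cubicDisc v))

theorem covariantPair_norm {v : ℤ × ℤ × ℤ × ℤ} (hv : IsSquare (cubicDisc v)) :
    (covariantPair v).1 ^ 2 + 3 * (covariantPair v).2 ^ 2 = 4 * hessianLead v ^ 3 := by
  obtain ⟨m, hm⟩ := hv
  have h : Int.sqrt (cubicDisc v) ^ 2 = cubicDisc v := by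
    rw [hm, Int.sqrt_eq, sq, ← Nat.cast_mul, Int.natAbs_mul_self]
  rw [← covariantLead_sq_add]
  unfold covariantPair
  linear_combination 27 * v.2.2.2 ^ 2 * h

theorem hessianLead_pos {v : ℤ × ℤ × ℤ × ℤ} (ha : v.2.2.2 ≠ 0) (hd : cubicDisc v ≠ 0)
    (hv : IsSquare (cubicDisc v)) : 0 < hessianLead v := by
  have h := covariantLead_sq_add v
  have h1 : 0 < cubicDisc v := lt_of_le_of_ne hv.nonneg hd.symm
  have h2 : 0 < v.2.2.2 ^ 2 * cubicDisc v := by positivity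
  have h3 : 0 < hessianLead v ^ 3 := by nlinarith [sq_nonneg (covariantLead v)]
  exact (Odd.pow_pos_iff (by decide)).mp h3

theorem eq_of_covariantLead_eq {v w : ℤ × ℤ × ℤ × ℤ} (ha : v.2.2.2 ≠ 0) (h : v.2 = w.2)
    (hc : covariantLead v = covariantLead w) : v = w := by
  refine Prod.ext ?_ h
  unfold covariantLead at hc
  rw [h] at hc ha
  refine mul_left_cancel₀ (pow_ne_zero 2 ha) ?_
  linarith

/-- The quadruples of integers with entries of absolute value at most `N`. -/
def box (N : ℕ) : Finset (ℤ × ℤ × ℤ × ℤ) :=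
  Finset.Icc (-N : ℤ) N ×ˢ Finset.Icc (-N : ℤ) N ×ˢ Finset.Icc (-N : ℤ) N ×ˢ Finset.Icc (-N : ℤ) N

theorem mem_box {N : ℕ} {v : ℤ × ℤ × ℤ × ℤ} :
    v ∈ box N ↔ |v.1| ≤ N ∧ |v.2.1| ≤ N ∧ |v.2.2.1| ≤ N ∧ |v.2.2.2| ≤ N := by
  simp [box, abs_le]

theorem hessianLead_le {N : ℕ} {v : ℤ × ℤ × ℤ × ℤ} (hv : v ∈ box N) :
    hessianLead v ≤ 4 * N ^ 2 := by
  obtain ⟨_, hc, hb, ha⟩ := mem_box.mp hv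
  have h1 : v.2.2.1 ^ 2 ≤ (N : ℤ) ^ 2 := by
    rw [← sq_abs]
    gcongr
  have h2 : |v.2.2.2 * v.2.1| ≤ (N : ℤ) * N := by
    rw [abs_mul]
    gcongr
  have h3 := (abs_le.mp h2).1
  unfold hessianLead
  linarith

theorem card_disc_eq_zero_le {S : Finset (ℤ × ℤ × ℤ × ℤ)} {N : ℕ} (hS : S ⊆ box N)
    (ha : ∀ v ∈ S, v.2.2.2 ≠ 0) (hd : ∀ v ∈ S, cubicDisc v = 0) :
    S.card ≤ 2 * (2 * N + 1) ^ 3 := by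
  let I := Finset.Icc (-N : ℤ) N
  have hI : I.card = 2 * N + 1 := by simp [I]; omega
  calc S.card ≤ ((Finset.univ : Finset Bool) ×ˢ I ×ˢ I ×ˢ I).card := by
        refine Finset.card_le_card_of_injOn (fun v => (decide (0 ≤ covariantLead v), v.2)) ?_ ?_
        · intro v hv
          have h := Finset.mem_product.mp (hS hv)
          exact Finset.mem_coe.mpr (Finset.mem_product.mpr ⟨Finset.mem_univ _, h.2⟩)
        · intro v hv w hw hvw
          obtain ⟨hs, h⟩ := Prod.mk.inj hvw
          refine eq_of_covariantLead_eq (ha v hv) h ?_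
          have h1 := covariantLead_sq_add v
          have h2 := covariantLead_sq_add w
          rw [hd v hv] at h1
          rw [hd w hw] at h2
          have h3 : covariantLead v ^ 2 = covariantLead w ^ 2 := by
            have : hessianLead v = hessianLead w := by unfold hessianLead; rw [h]
            rw [this] at h1
            linarith
          rw [decide_eq_decide] at hs
          rcases sq_eq_sq_iff_eq_or_eq_neg.mp h3 with h4 | h4 <;> omega
    _ = 2 * (2 * N + 1) ^ 3 := by
        simp only [Finset.card_product, hI, Finset.card_univ, Fintype.card_bool]
        ring

theorem card_covariantPair_le {S : Finset (ℤ × ℤ × ℤ × ℤ)} {N D : ℕ} {A : ℤ} (hS : S ⊆ box N)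
    (hD : ∀ n : ℕ, 0 < n → n ≤ 256 * N ^ 6 → n.divisors.card ≤ D)
    (ha : ∀ v ∈ S, v.2.2.2 ≠ 0) (hd : ∀ v ∈ S, cubicDisc v ≠ 0)
    (hsq : ∀ v ∈ S, IsSquare (cubicDisc v)) (hA : ∀ v ∈ S, hessianLead v = A) :
    (S.image covariantPair).card ≤ 26 * D ^ 2 := by
  rcases S.eq_empty_or_nonempty with rfl | ⟨w, hw⟩
  · simp
  have hpos : 0 < A := hA w hw ▸ hessianLead_pos (ha w hw) (hd w hw) (hsq w hw)
  have hle : A ≤ 4 * N ^ 2 := hA w hw ▸ hessianLead_le (hS hw)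
  lift A to ℕ using hpos.le
  have hpos' : 0 < 4 * A ^ 3 := by
    have : 0 < A := by exact_mod_cast hpos
    positivity
  have hle' : 4 * A ^ 3 ≤ 256 * N ^ 6 := by
    have : A ≤ 4 * N ^ 2 := by exact_mod_cast hle
    calc 4 * A ^ 3 ≤ 4 * (4 * N ^ 2) ^ 3 := by gcongr
      _ = 256 * N ^ 6 := by ring
  calc _ ≤ 26 * (4 * A ^ 3).divisors.card ^ 2 := by
        refine card_sq_add_three_mul_sq_le hpos' ?_
        intro p hp
        obtain ⟨v, hv, rfl⟩ := Finset.mem_image.mp hp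
        rw [covariantPair_norm (hsq v hv), hA v hv]
        push_cast
        ring
    _ ≤ 26 * D ^ 2 := by
        gcongr
        exact hD _ hpos' hle'

theorem card_leading_coeff_small_le {S : Finset (ℤ × ℤ × ℤ × ℤ)} {N D T : ℕ} (hS : S ⊆ box N)
    (hD : ∀ n : ℕ, 0 < n → n ≤ 256 * N ^ 6 → n.divisors.card ≤ D)
    (ha : ∀ v ∈ S, v.2.2.2 ≠ 0) (hd : ∀ v ∈ S, cubicDisc v ≠ 0)
    (hsq : ∀ v ∈ S, IsSquare (cubicDisc v)) (hT : ∀ v ∈ S, |v.2.2.2| ≤ T) :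
    S.card ≤ 26 * D ^ 2 * ((2 * N + 1) ^ 2 * (2 * T + 1)) := by
  let I := Finset.Icc (-N : ℤ) N
  let J := Finset.Icc (-T : ℤ) T
  have hI : I.card = 2 * N + 1 := by simp [I]; omega
  have hJ : J.card = 2 * T + 1 := by simp [J]; omega
  have hcard : (I ×ˢ I ×ˢ J).card = (2 * N + 1) ^ 2 * (2 * T + 1) := by
    simp only [Finset.card_product, hI, hJ]
    ring
  rw [← hcard]
  refine Finset.card_le_mul_card_image_of_maps_to (f := fun v => v.2) ?_ _ ?_
  · intro v hv
    obtain ⟨_, h1, h2, _⟩ := mem_box.mp (hS hv)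
    simp only [I, J, Finset.mem_product, Finset.mem_Icc]
    exact ⟨abs_le.mp h1, abs_le.mp h2, abs_le.mp (hT v hv)⟩
  · intro u _
    set F := S.filter fun v => v.2 = u
    have hF : ∀ v ∈ F, v ∈ S ∧ v.2 = u := fun v hv => Finset.mem_filter.mp hv
    have hinj : Set.InjOn covariantPair F := by
      intro v hv w hw hvw
      exact eq_of_covariantLead_eq (ha v (hF v hv).1) ((hF v hv).2.trans (hF w hw).2.symm)
        (Prod.mk.inj hvw).1
    rw [← Finset.card_image_of_injOn hinj]
    refine card_covariantPair_le (A := u.2.1 ^ 2 - 3 * u.2.2 * u.1)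
      ((Finset.filter_subset _ _).trans hS) hD (fun v hv => ha v (hF v hv).1)
      (fun v hv => hd v (hF v hv).1) (fun v hv => hsq v (hF v hv).1) ?_
    intro v hv
    rw [← (hF v hv).2, hessianLead]

theorem eq_of_covariants_eq {v w : ℤ × ℤ × ℤ × ℤ} (ha : v.2.2.2 ≠ 0)
    (haa : v.2.2.2 = w.2.2.2) (hbb : v.2.2.1 = w.2.2.1) (hh : hessianLead v = hessianLead w)
    (hc : covariantLead v = covariantLead w) : v = w := by
  refine eq_of_covariantLead_eq ha (Prod.ext ?_ (Prod.ext hbb haa)) hc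
  unfold hessianLead at hh
  rw [← haa, ← hbb] at hh
  refine mul_left_cancel₀ ha ?_
  linarith

theorem card_covariants_fixed_le {S : Finset (ℤ × ℤ × ℤ × ℤ)} {N D s k : ℕ} {A U : ℤ}
    (hS : S ⊆ box N) (hs : 0 < s)
    (hD : ∀ n : ℕ, 0 < n → n ≤ 256 * N ^ 6 → n.divisors.card ≤ D)
    (ha : ∀ v ∈ S, v.2.2.2 ≠ 0) (hk : ∀ v ∈ S, v.2.2.2.natAbs = k) (hsk : s ^ 2 ≤ k)
    (hA : ∀ v ∈ S, hessianLead v = A) (hU : ∀ v ∈ S, covariantLead v = U) :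
    S.card ≤ 2 * ((2 * N / s + 1) * D) := by
  rcases S.eq_empty_or_nonempty with rfl | ⟨w, hw⟩
  · simp
  have hkpos : 0 < 3 * k := by
    have := Int.natAbs_pos.mpr (ha w hw)
    rw [hk w hw] at this
    omega
  have hkN : k ≤ N := by
    have := (mem_box.mp (hS hw)).2.2.2
    rw [Int.abs_eq_natAbs, hk w hw] at this
    exact_mod_cast this
  have hle : 3 * k ≤ 256 * N ^ 6 := by
    have := Nat.le_self_pow (n := 6) (by norm_num) N
    omega
  calc S.card ≤ ((Finset.univ : Finset Bool) ×ˢ S.image fun v => v.2.2.1).card := by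
        refine Finset.card_le_card_of_injOn (fun v => (decide (0 ≤ v.2.2.2), v.2.2.1)) ?_ ?_
        · intro v hv
          exact Finset.mem_coe.mpr (Finset.mem_product.mpr
            ⟨Finset.mem_univ _, Finset.mem_image_of_mem _ hv⟩)
        · intro v hv w hw hvw
          obtain ⟨h1, h2⟩ := Prod.mk.inj hvw
          rw [decide_eq_decide] at h1
          refine eq_of_covariants_eq (ha v hv) ?_ h2 ((hA v hv).trans (hA w hw).symm)
            ((hU v hv).trans (hU w hw).symm)
          have := hk v hv
          have := hk w hw
          omega
    _ = 2 * (S.image fun v => v.2.2.1).card := by simp [Finset.card_product]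
    _ ≤ 2 * ((2 * N / s + 1) * (3 * k).divisors.card) := by
        gcongr
        refine card_sq_congruent_le (A := A) hs (by omega) ?_ ?_
        · intro b hb
          obtain ⟨v, hv, rfl⟩ := Finset.mem_image.mp hb
          exact (mem_box.mp (hS hv)).2.2.1
        · intro b hb
          obtain ⟨v, hv, rfl⟩ := Finset.mem_image.mp hb
          rw [← hA v hv, ← hk v hv, hessianLead, sub_sub_cancel]
          push_cast
          refine Dvd.dvd.mul_right (mul_dvd_mul_left 3 ?_) _
          exact (abs_dvd _ _).mpr dvd_rfl
    _ ≤ _ := by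
        gcongr
        exact hD _ hkpos hle

theorem card_leading_coeff_large_le {S : Finset (ℤ × ℤ × ℤ × ℤ)} {N D s : ℕ} (hS : S ⊆ box N)
    (hs : 0 < s) (hD : ∀ n : ℕ, 0 < n → n ≤ 256 * N ^ 6 → n.divisors.card ≤ D)
    (ha : ∀ v ∈ S, v.2.2.2 ≠ 0) (hd : ∀ v ∈ S, cubicDisc v ≠ 0)
    (hsq : ∀ v ∈ S, IsSquare (cubicDisc v)) (hT : ∀ v ∈ S, (s : ℤ) ^ 2 ≤ |v.2.2.2|) :
    S.card ≤ 2 * ((2 * N / s + 1) * D) * D * (26 * D ^ 2) * (4 * N ^ 2) := by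
  have hcard : (Finset.Icc (1 : ℤ) (4 * N ^ 2)).card = 4 * N ^ 2 := by
    rw [Int.card_Icc, add_sub_cancel_right]
    exact_mod_cast Int.toNat_natCast (4 * N ^ 2)
  rw [← hcard]
  refine Finset.card_le_mul_card_image_of_maps_to (f := hessianLead) ?_ _ ?_
  · intro v hv
    exact Finset.mem_Icc.mpr ⟨hessianLead_pos (ha v hv) (hd v hv) (hsq v hv),
      hessianLead_le (hS hv)⟩
  intro A _
  set F := S.filter fun v => hessianLead v = A
  have hF : ∀ v ∈ F, v ∈ S ∧ hessianLead v = A := fun v hv => Finset.mem_filter.mp hv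
  have hFS : F ⊆ S := Finset.filter_subset _ _
  calc F.card ≤ 2 * ((2 * N / s + 1) * D) * D * (F.image covariantPair).card := by
        refine Finset.card_le_mul_card_image_of_maps_to
          (fun v hv => Finset.mem_image_of_mem covariantPair hv) _ ?_
        intro p hp
        obtain ⟨w, hwF, rfl⟩ := Finset.mem_image.mp hp
        obtain ⟨hw, hwA⟩ := hF w hwF
        set y := (covariantPair w).2 with hy
        have hy0 : y ≠ 0 := by
          obtain ⟨m, hm⟩ := hsq w hw
          have hm0 : m ≠ 0 := fun h => hd w hw (by simp [hm, h])
          simp only [hy, covariantPair, hm, Int.sqrt_eq]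
          have := ha w hw
          positivity
        have hyle : y.natAbs ≤ 256 * N ^ 6 := by
          have h1 := covariantPair_norm (hsq w hw)
          have h2 := hessianLead_le (hS hw)
          have h3 := hessianLead_pos (ha w hw) (hd w hw) (hsq w hw)
          have h4 : 4 * hessianLead w ^ 3 ≤ 4 * (4 * (N : ℤ) ^ 2) ^ 3 := by gcongr
          have h5 : |y| ≤ y ^ 2 := by
            rw [← sq_abs]
            exact le_self_pow₀ (Int.one_le_abs hy0) two_ne_zero
          zify
          rw [← hy] at h1
          nlinarith [sq_nonneg (covariantPair w).1, sq_nonneg y]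
        set G := F.filter fun v => covariantPair v = covariantPair w
        have hG : ∀ v ∈ G, v ∈ F ∧ covariantPair v = covariantPair w :=
          fun v hv => Finset.mem_filter.mp hv
        have hGS : G ⊆ S := (Finset.filter_subset _ _).trans hFS
        calc G.card ≤ 2 * ((2 * N / s + 1) * D) * y.natAbs.divisors.card := by
              refine Finset.card_le_mul_card_image_of_maps_to
                (f := fun v => v.2.2.2.natAbs) ?_ _ ?_
              · intro v hv
                refine Nat.mem_divisors.mpr ⟨Int.natAbs_dvd_natAbs.mpr ?_, by simpa using hy0⟩
                rw [hy, ← (hG v hv).2]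
                exact ⟨3 * Int.sqrt (cubicDisc v), by simp only [covariantPair]; ring⟩
              · intro k _
                set H := G.filter fun v => v.2.2.2.natAbs = k
                rcases H.eq_empty_or_nonempty with hemp | ⟨u, hu⟩
                · simp [hemp]
                have hH : ∀ v ∈ H, v ∈ G ∧ v.2.2.2.natAbs = k :=
                  fun v hv => Finset.mem_filter.mp hv
                refine card_covariants_fixed_le (A := A) (U := covariantLead w)
                  ((Finset.filter_subset _ _).trans (hGS.trans hS)) hs hD
                  (fun v hv => ha v (hGS (hH v hv).1)) (fun v hv => (hH v hv).2) ?_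
                  (fun v hv => (hF v (hG v (hH v hv).1).1).2)
                  (fun v hv => (Prod.mk.inj (hG v (hH v hv).1).2).1)
                have := hT u (hGS (hH u hu).1)
                rw [Int.abs_eq_natAbs, (hH u hu).2] at this
                exact_mod_cast this
          _ ≤ _ := by
              gcongr
              exact hD _ (Int.natAbs_pos.mpr hy0) hyle
    _ ≤ _ := by
        gcongr
        exact card_covariantPair_le (hFS.trans hS) hD (fun v hv => ha v (hFS hv))
          (fun v hv => hd v (hFS hv)) (fun v hv => hsq v (hFS hv)) (fun v hv => (hF v hv).2)

theorem exists_fourth_root (N : ℕ) (hN : 0 < N) : ∃ s : ℕ, 0 < s ∧ s ^ 4 ≤ N ∧ N ≤ 16 * s ^ 4 := by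
  have hex : ∃ t : ℕ, N < (t + 1) ^ 4 := ⟨N, by
    have := Nat.le_self_pow (n := 4) (by norm_num) (N + 1)
    omega⟩
  have hs : 0 < Nat.find hex := by
    rw [Nat.find_pos]
    omega
  have hlt := Nat.find_spec hex
  have hle := Nat.find_min hex (Nat.sub_lt hs one_pos)
  set s := Nat.find hex
  refine ⟨s, hs, by rwa [Nat.sub_add_cancel (n := s) (m := 1) hs, not_lt] at hle, hlt.le.trans ?_⟩
  calc (s + 1) ^ 4 ≤ (2 * s) ^ 4 := by gcongr; omega
    _ = 16 * s ^ 4 := by ring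

theorem exists_uniform_card_divisors_le : ∃ C : ℕ, ∀ N s : ℕ, N ≤ 16 * s ^ 4 →
    ∃ D : ℕ, D ^ 4 ≤ C * s ∧ ∀ n : ℕ, 0 < n → n ≤ 256 * N ^ 6 → n.divisors.card ≤ D := by
  obtain ⟨C, hdiv⟩ := exists_card_divisors_pow_le 96
  refine ⟨C * (256 * 16 ^ 6), fun N s hN => ?_⟩
  obtain ⟨D, hD, hsup⟩ : ∃ D : ℕ, D ^ 96 ≤ C * (256 * N ^ 6) ∧
      ∀ n : ℕ, 0 < n → n ≤ 256 * N ^ 6 → n.divisors.card ≤ D := by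
    rcases (Finset.Icc 1 (256 * N ^ 6)).eq_empty_or_nonempty with h | h
    · refine ⟨0, by simp, fun n h1 h2 => ?_⟩
      have : n ∈ Finset.Icc 1 (256 * N ^ 6) := Finset.mem_Icc.mpr ⟨h1, h2⟩
      simp [h] at this
    · obtain ⟨n₀, hn₀, hmax⟩ := Finset.exists_max_image _ (fun n : ℕ => n.divisors.card) h
      obtain ⟨h1, h2⟩ := Finset.mem_Icc.mp hn₀
      exact ⟨n₀.divisors.card, (hdiv n₀ (by omega)).trans (by gcongr),
        fun n h1 h2 => hmax n (Finset.mem_Icc.mpr ⟨h1, h2⟩)⟩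
  refine ⟨D, ?_, hsup⟩
  refine (Nat.pow_le_pow_iff_left (n := 24) (by norm_num)).mp ?_
  calc (D ^ 4) ^ 24 = D ^ 96 := by rw [← pow_mul]
    _ ≤ C * (256 * N ^ 6) := hD
    _ ≤ C * (256 * (16 * s ^ 4) ^ 6) := by gcongr
    _ = C * (256 * 16 ^ 6) * s ^ 24 := by ring
    _ ≤ (C * (256 * 16 ^ 6)) ^ 24 * s ^ 24 := by
        gcongr
        exact Nat.le_self_pow (by norm_num) _
    _ = (C * (256 * 16 ^ 6) * s) ^ 24 := (mul_pow _ _ _).symm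

theorem exists_card_square_disc_le : ∃ C : ℕ, ∀ N : ℕ, 0 < N →
    ((box N).filter fun v => v.2.2.2 ≠ 0 ∧ IsSquare (cubicDisc v)).card ≤ C * N ^ 3 := by
  obtain ⟨C, hC⟩ := exists_uniform_card_divisors_le
  refine ⟨54 + 702 * C + 624 * C, fun N hN => ?_⟩
  obtain ⟨s, hs, hsN, hNs⟩ := exists_fourth_root N hN
  obtain ⟨D, hDs, hD⟩ := hC N s hNs
  set S := (box N).filter fun v => v.2.2.2 ≠ 0 ∧ IsSquare (cubicDisc v)
  have hS : ∀ v ∈ S, v ∈ box N ∧ v.2.2.2 ≠ 0 ∧ IsSquare (cubicDisc v) :=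
    fun v hv => Finset.mem_filter.mp hv
  set S₀ := S.filter fun v => cubicDisc v = 0
  set S₁ := S.filter fun v => cubicDisc v ≠ 0 ∧ |v.2.2.2| ≤ (s ^ 2 : ℕ)
  set S₂ := S.filter fun v => cubicDisc v ≠ 0 ∧ (s : ℤ) ^ 2 ≤ |v.2.2.2|
  have hcover : S ⊆ S₀ ∪ (S₁ ∪ S₂) := by
    intro v hv
    simp only [S₀, S₁, S₂, Finset.mem_union, Finset.mem_filter, hv, true_and]
    push_cast
    have := le_total |v.2.2.2| ((s : ℤ) ^ 2)
    tauto
  have hDD : D ^ 2 ≤ D ^ 4 := by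
    rcases Nat.eq_zero_or_pos D with rfl | h
    · simp
    · exact Nat.pow_le_pow_right h (by norm_num)
  have hss : s ≤ s ^ 4 := Nat.le_self_pow (by norm_num) s
  have h0 : S₀.card ≤ 54 * N ^ 3 := by
    calc S₀.card ≤ 2 * (2 * N + 1) ^ 3 := by
          refine card_disc_eq_zero_le (fun v hv => ?_) (fun v hv => ?_) (fun v hv => ?_)
          · exact (hS v (Finset.mem_filter.mp hv).1).1
          · exact (hS v (Finset.mem_filter.mp hv).1).2.1
          · exact (Finset.mem_filter.mp hv).2
      _ ≤ 2 * (3 * N) ^ 3 := by gcongr; omega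
      _ = 54 * N ^ 3 := by ring
  have h1 : S₁.card ≤ 702 * C * N ^ 3 := by
    calc S₁.card ≤ 26 * D ^ 2 * ((2 * N + 1) ^ 2 * (2 * s ^ 2 + 1)) := by
          refine card_leading_coeff_small_le (fun v hv => ?_) hD (fun v hv => ?_) (fun v hv => ?_)
            (fun v hv => ?_) (fun v hv => ?_)
          · exact (hS v (Finset.mem_filter.mp hv).1).1
          · exact (hS v (Finset.mem_filter.mp hv).1).2.1
          · exact (Finset.mem_filter.mp hv).2.1
          · exact (hS v (Finset.mem_filter.mp hv).1).2.2
          · exact (Finset.mem_filter.mp hv).2.2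
      _ ≤ 26 * (C * s) * ((3 * N) ^ 2 * (3 * s ^ 2)) := by
          have : 0 < s ^ 2 := by positivity
          gcongr
          · exact hDD.trans hDs
          · omega
          · omega
      _ = 702 * C * N ^ 2 * s ^ 3 := by ring
      _ ≤ 702 * C * N ^ 2 * N := by
          gcongr
          exact (Nat.pow_le_pow_right hs (by norm_num)).trans hsN
      _ = 702 * C * N ^ 3 := by ring
  have h2 : S₂.card ≤ 624 * C * N ^ 3 := by
    calc S₂.card ≤ 2 * ((2 * N / s + 1) * D) * D * (26 * D ^ 2) * (4 * N ^ 2) := by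
          refine card_leading_coeff_large_le (fun v hv => ?_) hs hD (fun v hv => ?_)
            (fun v hv => ?_) (fun v hv => ?_) (fun v hv => ?_)
          · exact (hS v (Finset.mem_filter.mp hv).1).1
          · exact (hS v (Finset.mem_filter.mp hv).1).2.1
          · exact (Finset.mem_filter.mp hv).2.1
          · exact (hS v (Finset.mem_filter.mp hv).1).2.2
          · exact (Finset.mem_filter.mp hv).2.2
      _ = 208 * D ^ 4 * (2 * N / s + 1) * N ^ 2 := by ring
      _ ≤ 208 * (C * s) * (2 * N / s + 1) * N ^ 2 := by gcongr
      _ = 208 * C * (2 * N / s * s + s) * N ^ 2 := by ring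
      _ ≤ 208 * C * (2 * N + N) * N ^ 2 := by
          have h3 : 2 * N / s * s + s ≤ 2 * N + N :=
            Nat.add_le_add (Nat.div_mul_le_self _ _) (hss.trans hsN)
          gcongr ?_ * N ^ 2
          exact Nat.mul_le_mul_left _ h3
      _ = 624 * C * N ^ 3 := by ring
  calc S.card ≤ S₀.card + (S₁.card + S₂.card) :=
        (Finset.card_le_card hcover).trans
          ((Finset.card_union_le _ _).trans (by gcongr; exact Finset.card_union_le _ _))
    _ ≤ 54 * N ^ 3 + (702 * C * N ^ 3 + 624 * C * N ^ 3) := by gcongr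
    _ = _ := by ring

/-- There is `C > 0` such that for every `X ≥ 2`, the number of quadruples
`(n₀,n₁,n₂,n₃) ∈ ℤ⁴` with `|nᵢ| ≤ X`, `n₃ ≠ 0`, whose cubic discriminant
`n₁²n₂² − 4n₁³n₃ − 4n₀n₂³ − 27n₀²n₃² + 18n₀n₁n₂n₃` is a perfect square, is at most
`C X³ log X`. -/
theorem count_square_discriminant :
    ∃ C > (0:ℝ), ∀ X : ℝ, 2 ≤ X →
      (Nat.card {v : ℤ × ℤ × ℤ × ℤ //
          (|v.1| : ℝ) ≤ X ∧ (|v.2.1| : ℝ) ≤ X ∧ (|v.2.2.1| : ℝ) ≤ X ∧ (|v.2.2.2| : ℝ) ≤ X ∧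
          v.2.2.2 ≠ 0 ∧
          ∃ m : ℤ,
            v.2.1 ^ 2 * v.2.2.1 ^ 2 - 4 * v.2.1 ^ 3 * v.2.2.2 - 4 * v.1 * v.2.2.1 ^ 3
              - 27 * v.1 ^ 2 * v.2.2.2 ^ 2 + 18 * v.1 * v.2.1 * v.2.2.1 * v.2.2.2 = m ^ 2} : ℝ)
        ≤ C * X ^ 3 * Real.log X := by
  obtain ⟨C, hC⟩ := exists_card_square_disc_le
  have hlog2 : 0 < Real.log 2 := Real.log_pos (by norm_num)
  refine ⟨(C + 1) / Real.log 2, by positivity, fun X hX => ?_⟩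
  have hX0 : 0 ≤ X := by linarith
  set N := ⌊X⌋₊ with hNdef
  have hN : 0 < N := Nat.floor_pos.mpr (by linarith)
  have habs : ∀ z : ℤ, |(z : ℝ)| ≤ X ↔ |z| ≤ N := by
    intro z
    rw [← Int.cast_abs, Int.abs_eq_natAbs, Int.cast_natCast, hNdef, Nat.cast_le,
      Nat.le_floor_iff hX0]
  have hcard : Nat.card {v : ℤ × ℤ × ℤ × ℤ //
      (|v.1| : ℝ) ≤ X ∧ (|v.2.1| : ℝ) ≤ X ∧ (|v.2.2.1| : ℝ) ≤ X ∧ (|v.2.2.2| : ℝ) ≤ X ∧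
      v.2.2.2 ≠ 0 ∧
      ∃ m : ℤ,
        v.2.1 ^ 2 * v.2.2.1 ^ 2 - 4 * v.2.1 ^ 3 * v.2.2.2 - 4 * v.1 * v.2.2.1 ^ 3
          - 27 * v.1 ^ 2 * v.2.2.2 ^ 2 + 18 * v.1 * v.2.1 * v.2.2.1 * v.2.2.2 = m ^ 2} =
      ((box N).filter fun v => v.2.2.2 ≠ 0 ∧ IsSquare (cubicDisc v)).card := by
    refine Nat.subtype_card _ fun v => ?_
    simp only [Finset.mem_filter, mem_box, habs, cubicDisc, isSquare_iff_exists_sq, and_assoc]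
  rw [hcard]
  have hlog : Real.log 2 ≤ Real.log X := Real.log_le_log (by norm_num) hX
  calc _ ≤ (C : ℝ) * N ^ 3 := by exact_mod_cast hC N hN
    _ ≤ (C + 1) * X ^ 3 := by
        gcongr
        · linarith
        · exact Nat.floor_le hX0
    _ = (C + 1) / Real.log 2 * X ^ 3 * Real.log 2 := by field_simp
    _ ≤ _ := by gcongr

end
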